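/- Let μ be the stationary Markov measure on {a,b}^ℕ with transition probabilities p_{aa} = p, p_{bb} = q, 0 < p,q < 1, and let f be the run-length encoder. Then the Rényi entropy of order 2 of the pushforward measure exists and H₂(f_*μ) = −(1/2)·log( (1−p)(1−q) / ((1+p)(1+q)) ). -/

import Mathlib

open MeasureTheory Filter Topology

section RLEDefs

variable {A : Type*}

/-- The starting position of the run following the run that starts at position `i`:
the least index `> i` where the value of `x` changes (with the junk convention `i + 1`
if the sequence is constant from position `i` on). -/
noncomputable def nextChange (x : ℕ → A) (i : ℕ) : ℕ := by
  classical
  exact if h : ∃ j, x (i + j + 1) ≠ x i then i + Nat.find h + 1 else i + 1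

/-- Starting position of the `n`-th maximal run of the sequence `x`. -/
noncomputable def runStart (x : ℕ → A) : ℕ → ℕ
  | 0 => 0
  | n + 1 => nextChange x (runStart x n)

/-- The run-length encoder `f : A^ℕ → (A × ℕ)^ℕ`: the `n`-th symbol of `f x` is the pair
(value of the `n`-th maximal run of `x`, length of that run). -/
noncomputable def rle (x : ℕ → A) (n : ℕ) : A × ℕ :=
  (x (runStart x n), runStart x (n + 1) - runStart x n)

/-- `M_n(u,v)`: the length of the longest common substring of `u` and `v`
occurring within their first `n` symbols, i.e.
`max {k : u_i^{i+k-1} = v_j^{j+k-1} for some 0 ≤ i,j ≤ n-k}`. -/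
noncomputable def matchLen {C : Type*} (u v : ℕ → C) (n : ℕ) : ℕ :=
  sSup {k | ∃ i j, i + k ≤ n ∧ j + k ≤ n ∧ ∀ m < k, u (i + m) = v (j + m)}

/-- `M^RLE_n(x,y) = M_n(f x, f y)`. -/
noncomputable def MRLE (x y : ℕ → A) (n : ℕ) : ℕ := matchLen (rle x) (rle y) n

/-- `M̃_n(x,y) = max {k : f(σ^i x)_1^k = f(σ^j y)_1^k for some 0 ≤ i,j ≤ n-k}`. -/
noncomputable def Mtilde (x y : ℕ → A) (n : ℕ) : ℕ :=
  sSup {k | ∃ i j, i + k ≤ n ∧ j + k ≤ n ∧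
    ∀ m < k, rle (fun t => x (t + i)) m = rle (fun t => y (t + j)) m}

/-- The number of maximal runs in the first `n` symbols of `x`, i.e. `|f(x_1^n)|`. -/
noncomputable def runCount (x : ℕ → A) (n : ℕ) : ℕ := by
  classical
  exact ((Finset.range n).filter fun i => i = 0 ∨ x i ≠ x (i - 1)).card

/-- The left shift `σ` on sequences. -/
def shift (x : ℕ → A) : ℕ → A := fun n => x (n + 1)

variable [MeasurableSpace A]

/-- `Σ_{ω ∈ B^n} (f_*μ)(ω)²`: the sum, over all cylinders `ω` of length `n` in
`B^ℕ = (A × ℕ)^ℕ`, of the squared measure of `f⁻¹ω` (where `f` is the run-length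
encoder), i.e. of the squared pushforward measure of the cylinder. -/
noncomputable def pushCylSum (μ : Measure (ℕ → A)) (n : ℕ) : ℝ :=
  ∑' ω : Fin n → A × ℕ, ((μ {x | ∀ i : Fin n, rle x i = ω i}).toReal) ^ 2

/-- Lower Rényi entropy of order 2 of the pushforward measure `f_*μ`:
`H̲₂(f_*μ) = - liminf_n (1/n) log Σ_ω (f_*μ)(ω)²`. -/
noncomputable def H2lower (μ : Measure (ℕ → A)) : ℝ :=
  -liminf (fun n : ℕ => Real.log (pushCylSum μ n) / n) atTop

/-- Upper Rényi entropy of order 2 of the pushforward measure `f_*μ`: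
`H̄₂(f_*μ) = - limsup_n (1/n) log Σ_ω (f_*μ)(ω)²`. -/
noncomputable def H2upper (μ : Measure (ℕ → A)) : ℝ :=
  -limsup (fun n : ℕ => Real.log (pushCylSum μ n) / n) atTop

/-- Hypothesis (A): there are `c > 0`, `h > 0` with `μ(a…a) ≤ c e^{-hn}` for every
constant cylinder `a…a` of length `n`. -/
def HypA (μ : Measure (ℕ → A)) (c h : ℝ) : Prop :=
  0 < c ∧ 0 < h ∧
    ∀ (n : ℕ) (a : A), μ {x | ∀ i < n, x i = a} ≤ ENNReal.ofReal (c * Real.exp (-h * n))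

/-- The σ-algebra `F_0^n` generated by the coordinates `X_0, …, X_n`. -/
def cylAlgLE (A : Type*) [MeasurableSpace A] (n : ℕ) : MeasurableSpace (ℕ → A) :=
  MeasurableSpace.comap (fun x (i : Fin (n + 1)) => x i) inferInstance

/-- The σ-algebra `F_m^∞` generated by the coordinates `X_m, X_{m+1}, …`. -/
def cylAlgGE (A : Type*) [MeasurableSpace A] (m : ℕ) : MeasurableSpace (ℕ → A) :=
  MeasurableSpace.comap (fun x (i : ℕ) => x (m + i)) inferInstance

/-- α-mixing with rate function `a`: for all `n, g` and all `S ∈ F_0^n`, `T ∈ F_{n+g}^∞`,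
`|μ(S ∩ T) - μ(S)μ(T)| ≤ a(g)`. -/
def AlphaMixingBound (μ : Measure (ℕ → A)) (a : ℕ → ℝ) : Prop :=
  ∀ (n g : ℕ) (S T : Set (ℕ → A)),
    MeasurableSet[cylAlgLE A n] S → MeasurableSet[cylAlgGE A (n + g)] T →
    |(μ (S ∩ T)).toReal - (μ S).toReal * (μ T).toReal| ≤ a g

/-- α-mixing with exponential decay. -/
def AlphaMixingExp (μ : Measure (ℕ → A)) : Prop :=
  ∃ C θ : ℝ, 0 < C ∧ 0 < θ ∧ AlphaMixingBound μ fun g => C * Real.exp (-θ * g)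

/-- ψ-mixing with polynomial rate `ψ(g) = g^{-a}`: for all `n` and `g ≥ 1` and all
`S ∈ F_0^n`, `T ∈ F_{n+g}^∞`, `|μ(S ∩ T) - μ(S)μ(T)| ≤ g^{-a} μ(S) μ(T)`. -/
def PsiMixingPoly (μ : Measure (ℕ → A)) (a : ℝ) : Prop :=
  ∀ (n g : ℕ), 1 ≤ g → ∀ (S T : Set (ℕ → A)),
    MeasurableSet[cylAlgLE A n] S → MeasurableSet[cylAlgGE A (n + g)] T →
    |(μ (S ∩ T)).toReal - (μ S).toReal * (μ T).toReal| ≤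
      (g : ℝ) ^ (-a) * (μ S).toReal * (μ T).toReal

/-- `S_n = Σ_{0 ≤ i,j ≤ n-1} 1_{A_{i,j}}` with `A_{i,j} = {f(σ^i X)_1^k = f(σ^j Y)_1^k}`,
seen as a random variable on the product space (X = first coordinate, Y = second). -/
noncomputable def Sn (k n : ℕ) (p : (ℕ → A) × (ℕ → A)) : ℝ := by
  classical
  exact ∑ i ∈ Finset.range n, ∑ j ∈ Finset.range n,
    if ∀ m < k, rle (fun t => p.1 (t + i)) m = rle (fun t => p.2 (t + j)) m then (1 : ℝ) else 0

end RLEDefs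

def flp (a : Bool) (i : ℕ) : Bool := Bool.not^[i] a

lemma flp_succ (a : Bool) (i : ℕ) : flp a (i+1) = !(flp a i) := by
  simp only [flp, Function.iterate_succ_apply']

def bT (p q : ℝ) (a b : Bool) : ℝ :=
  if a then (if b then p else 1 - p) else (if b then 1 - q else q)
noncomputable def bPi (p q : ℝ) (a : Bool) : ℝ :=
  if a then (1 - q) / (2 - p - q) else (1 - p) / (2 - p - q)
def bP (p q : ℝ) (a : Bool) : ℝ := if a then p else q

noncomputable def bV (p q : ℝ) (m : ℕ) (y : ℕ → Bool) : ℝ :=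
  bPi p q (y 0) * ∏ i ∈ Finset.range m, bT p q (y i) (y (i+1))

def ssum (k : ℕ → ℕ) (n : ℕ) : ℕ := ∑ i ∈ Finset.range n, (k i + 1)

def EvC (x : ℕ → Bool) : Prop := ∃ m, ∀ i, x (m + i) = x m

lemma bT_self (p q : ℝ) (a : Bool) : bT p q a a = bP p q a := by
  cases a <;> simp [bT, bP]
lemma bT_not (p q : ℝ) (a : Bool) : bT p q a (!a) = 1 - bP p q a := by
  cases a <;> simp [bT, bP]

lemma nextChange_eq_iff (x : ℕ → Bool) (hx : ¬ EvC x) (s k : ℕ) :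
    nextChange x s = s + k + 1 ↔ (∀ j ≤ k, x (s + j) = x s) ∧ x (s + k + 1) = !(x s) := by
  classical
  have h : ∃ j, x (s + j + 1) ≠ x s := by
    by_contra hc
    push Not at hc
    refine hx ⟨s, fun i => ?_⟩
    cases i with
    | zero => rfl
    | succ i => exact hc i
  have e : nextChange x s = s + Nat.find h + 1 := by
    unfold nextChange
    rw [dif_pos h]
    congr 2
    congr!
  rw [e]
  have : (s + Nat.find h + 1 = s + k + 1) ↔ Nat.find h = k := by omega
  rw [this, Nat.find_eq_iff]
  constructor
  · rintro ⟨h1, h2⟩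
    refine ⟨fun j hj => ?_, ?_⟩
    · cases j with
      | zero => rfl
      | succ j => exact not_not.mp (h2 j (by omega))
    · exact Bool.eq_not.mpr h1
  · rintro ⟨h1, h2⟩
    refine ⟨Bool.eq_not.mp h2, fun j hj => ?_⟩
    rw [not_not]
    exact h1 (j+1) (by omega)

lemma nextChange_lt (x : ℕ → Bool) (s : ℕ) : s < nextChange x s := by
  classical
  unfold nextChange
  split_ifs <;> omega

lemma runStart_of_rle (x : ℕ → Bool) (a : Bool) (k : ℕ → ℕ) (n : ℕ)
    (h : ∀ i < n, rle x i = (flp a i, k i + 1)) : runStart x n = ssum k n := by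
  induction n with
  | zero => rfl
  | succ n ih =>
    have h1 := ih (fun i hi => h i (by omega))
    have h2 := h n (by omega)
    have h3 := nextChange_lt x (runStart x n)
    simp only [rle, Prod.mk.injEq] at h2
    simp only [ssum, Finset.sum_range_succ] at *
    change nextChange x (runStart x n) = _
    have h4 : nextChange x (runStart x n) - runStart x n = k n + 1 := h2.2
    omega

lemma main_cyl (p q : ℝ) (a : Bool) (k : ℕ → ℕ) (n : ℕ) :
    ∃ y : ℕ → Bool, bV p q (ssum k n) y =
        bPi p q a * ∏ i ∈ Finset.range n, ((1 - bP p q (flp a i)) * bP p q (flp a i) ^ k i) ∧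
      y (ssum k n) = flp a n ∧ y 0 = a ∧
      ∀ x, ¬ EvC x → 
        ((x 0 = a ∧ ∀ i < n, rle x i = (flp a i, k i + 1)) ↔ ∀ i ≤ ssum k n, x i = y i) := by
  induction n with
  | zero => 
    refine ⟨fun _ => a, ?_, rfl, rfl, fun x hx => ?_⟩
    · simp [bV, ssum]
    · simp [ssum]
  | succ n ih =>
    obtain ⟨y, h1, h2, h0, h3⟩ := ih
    set s := ssum k n with hs
    have hs' : ssum k (n+1) = s + k n + 1 := by
      simp only [hs, ssum, Finset.sum_range_succ]; omega
    let y' : ℕ → Bool := fun j => if j < s then y j else if j ≤ s + k n then flp a n else flp a (n+1)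
    have ya : ∀ i ≤ s, y' i = y i := by
      intro i hi
      rcases hi.lt_or_eq with h | rfl
      · simp [y', h]
      · simp [y', h2]
    have yb : ∀ j ≤ k n, y' (s + j) = flp a n := by
      intro j hj
      simp [y', hj]
    have yc : y' (s + k n + 1) = flp a (n+1) := by
      have e1 : ¬ (s + k n + 1 < s) := by omega
      have e2 : ¬ (s + k n + 1 ≤ s + k n) := by omega
      simp only [y', e1, e2, if_false]
    refine ⟨y', ?_, by rw [hs', yc], by rw [ya 0 (Nat.zero_le _), h0], fun x hx => ?_⟩
    · rw [hs', Finset.prod_range_succ, ← mul_assoc, ← h1]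
      unfold bV
      rw [add_assoc, Finset.prod_range_add, ya 0 (Nat.zero_le _), ← mul_assoc]
      congr 1
      · congr 1
        refine Finset.prod_congr rfl fun i hi => ?_
        rw [Finset.mem_range] at hi
        rw [ya i hi.le, ya (i+1) hi]
      · rw [Finset.prod_range_succ, yb _ le_rfl, yc, flp_succ, bT_not, mul_comm]
        congr 1
        calc _ = ∏ j ∈ Finset.range (k n), bP p q (flp a n) := by
              refine Finset.prod_congr rfl fun j hj => ?_
              rw [Finset.mem_range] at hj
              rw [yb j hj.le, add_assoc, yb (j+1) hj, bT_self]
          _ = _ := by simp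
    · rw [hs']
      have key : (∀ i < n, rle x i = (flp a i, k i + 1)) → 
          (rle x n = (flp a n, k n + 1) ↔ 
            ((∀ j ≤ k n, x (s + j) = flp a n) ∧ x (s + k n + 1) = flp a (n+1))) := by
        intro h
        have hr := runStart_of_rle x a k n h
        rw [← hs] at hr
        have hlt := nextChange_lt x s
        have e : rle x n = (x s, nextChange x s - s) := by
          simp only [rle, runStart, hr]
        rw [e, Prod.mk.injEq, flp_succ]
        have : (nextChange x s - s = k n + 1) ↔ nextChange x s = s + k n + 1 := by omega
        rw [this, nextChange_eq_iff x hx]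
        constructor
        · rintro ⟨e1, e2, e3⟩
          rw [e1] at e2 e3
          exact ⟨e2, e3⟩
        · rintro ⟨e2, e3⟩
          have e1 : x s = flp a n := e2 0 (Nat.zero_le _)
          rw [e1]
          exact ⟨rfl, e2, e3⟩
      constructor
      · rintro ⟨hx0, h⟩ i hi
        have hh : ∀ i < n, rle x i = (flp a i, k i + 1) := fun i hi => h i (by omega)
        have hp := (h3 x hx).mp ⟨hx0, hh⟩
        obtain ⟨g1, g2⟩ := (key hh).mp (h n (by omega))
        by_cases c1 : i ≤ s
        · rw [hp i c1, ya i c1]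
        · by_cases c2 : i = s + k n + 1
          · rw [c2, g2, yc]
          · obtain ⟨j, rfl⟩ := Nat.exists_eq_add_of_le (not_le.mp c1).le
            rw [g1 j (by omega), yb j (by omega)]
      · intro h
        obtain ⟨hx0, hh⟩ := (h3 x hx).mpr (fun i hi => by rw [h i (by omega), ya i hi])
        refine ⟨hx0, fun i hi => ?_⟩
        rcases Nat.lt_succ_iff_lt_or_eq.mp hi with h' | rfl
        · exact hh i h'
        · refine (key hh).mpr ⟨fun j hj => ?_, ?_⟩
          · rw [h _ (by omega), yb j hj]
          · rw [h _ (by omega), yc]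

lemma bT_le (p q : ℝ) : ∀ a b, bT p q a b ≤ max (max p (1-p)) (max q (1-q)) := by
  intro a b
  cases a <;> cases b <;> simp [bT]

lemma bT_nonneg (p q : ℝ) (hp0 : 0 < p) (hp1 : p < 1) (hq0 : 0 < q) (hq1 : q < 1) (a b : Bool) :
    0 ≤ bT p q a b := by
  cases a <;> cases b <;> simp [bT] <;> linarith

lemma bPi_pos (p q : ℝ) (hp1 : p < 1) (hq1 : q < 1) (a : Bool) :
    0 < bPi p q a := by
  cases a <;> simp [bPi] <;> apply div_pos <;> linarith

lemma evC_countable : {x | EvC x}.Countable := by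
  have : {x | EvC x} ⊆ ⋃ m : ℕ, ⋃ b : Bool, Set.range
      (fun (w : Fin m → Bool) (i : ℕ) => if h : i < m then w ⟨i, h⟩ else b) := by
    rintro x ⟨m, hm⟩
    simp only [Set.mem_iUnion, Set.mem_range]
    refine ⟨m, x m, fun i => x i, ?_⟩
    funext i
    split_ifs with h
    · rfl
    · obtain ⟨j, rfl⟩ := Nat.exists_eq_add_of_le (not_lt.mp h)
      exact (hm j).symm
  exact (Set.countable_iUnion fun m => Set.countable_iUnion fun b => Set.countable_range _).mono this

lemma evC_null (p q : ℝ) (hp0 : 0 < p) (hp1 : p < 1) (hq0 : 0 < q) (hq1 : q < 1)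
    (μ : Measure (ℕ → Bool))
    (hV : ∀ m y, μ {x | ∀ i ≤ m, x i = y i} = ENNReal.ofReal (bV p q m y)) :
    μ {x | EvC x} = 0 := by
  rw [← Set.biUnion_of_singleton {x | EvC x}, measure_biUnion_null_iff evC_countable]
  intro y _
  set c := max (max p (1-p)) (max q (1-q)) with hc
  have hc1 : c < 1 := by simp [hc]; exact ⟨⟨hp1, hp0⟩, hq1, hq0⟩
  have hc0 : 0 ≤ c := le_trans hp0.le (by simp [hc])
  have hb : ∀ m, μ {y} ≤ ENNReal.ofReal (bPi p q (y 0) * c ^ m) := by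
    intro m
    calc μ {y} ≤ μ {x | ∀ i ≤ m, x i = y i} := by
          apply measure_mono
          rintro x rfl
          simp
      _ = _ := hV m y
      _ ≤ _ := by
          apply ENNReal.ofReal_le_ofReal
          unfold bV
          apply mul_le_mul_of_nonneg_left _ (bPi_pos p q hp1 hq1 _).le
          calc _ ≤ ∏ i ∈ Finset.range m, c := Finset.prod_le_prod
                (fun i _ => bT_nonneg p q hp0 hp1 hq0 hq1 _ _) (fun i _ => bT_le p q _ _)
            _ = c ^ m := by simp
  have ht : Tendsto (fun m => ENNReal.ofReal (bPi p q (y 0) * c ^ m)) atTop (𝓝 0) := by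
    have := (tendsto_pow_atTop_nhds_zero_of_lt_one hc0 hc1).const_mul (bPi p q (y 0))
    have := ENNReal.tendsto_ofReal this
    simpa using this
  exact le_antisymm (ge_of_tendsto' ht hb) bot_le

lemma rle_shape (x : ℕ → Bool) (hx : ¬ EvC x) (i : ℕ) :
    x (runStart x i) = flp (x 0) i ∧ ∃ k, (rle x i).2 = k + 1 := by
  constructor
  · induction i with
    | zero => rfl
    | succ i ih =>
      have h3 := nextChange_lt x (runStart x i)
      obtain ⟨k, hk⟩ := Nat.exists_eq_add_of_lt h3
      have := ((nextChange_eq_iff x hx _ k).mp hk).2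
      change x (nextChange x (runStart x i)) = _
      rw [hk, this, ih, flp_succ]
  · have h3 := nextChange_lt x (runStart x i)
    refine ⟨nextChange x (runStart x i) - runStart x i - 1, ?_⟩
    change nextChange x (runStart x i) - runStart x i = _
    omega

lemma tsum_pi_prod (n : ℕ) (f : ℕ → ℕ → ENNReal) :
    ∑' k : Fin n → ℕ, ∏ i : Fin n, f i (k i) = ∏ i ∈ Finset.range n, ∑' j, f i j := by
  induction n with
  | zero => simp
  | succ n ih =>
    rw [← (Fin.snocEquiv (fun _ : Fin (n+1) => ℕ)).tsum_eq, ENNReal.tsum_prod', Finset.prod_range_succ, ← ih,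
      mul_comm, ← ENNReal.tsum_mul_right]
    refine tsum_congr fun j => ?_
    rw [← ENNReal.tsum_mul_left]
    refine tsum_congr fun k => ?_
    rw [Fin.prod_univ_castSucc]
    simp [Fin.snocEquiv, mul_comm]

noncomputable def bR (p q : ℝ) (a : Bool) : ℝ := (1 - bP p q a) / (1 + bP p q a)

lemma bP_mem (p q : ℝ) (hp0 : 0 < p) (hp1 : p < 1) (hq0 : 0 < q) (hq1 : q < 1) (a : Bool) :
    0 < bP p q a ∧ bP p q a < 1 := by
  cases a <;> simp [bP, *]

lemma geo (P : ℝ) (h0 : 0 < P) (h1 : P < 1) :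
    ∑' j : ℕ, (ENNReal.ofReal ((1 - P) * P ^ j)) ^ 2 = ENNReal.ofReal ((1-P)/(1+P)) := by
  have hs : HasSum (fun j : ℕ => ((1 - P) * P ^ j)^2) ((1-P)/(1+P)) := by
    have := (hasSum_geometric_of_lt_one (r := P^2) (by positivity) (by nlinarith)).mul_left ((1-P)^2)
    have e : (1-P)^2 * (1 - P^2)⁻¹ = (1-P)/(1+P) := by
      have : (1:ℝ) - P^2 = (1-P)*(1+P) := by ring
      rw [this]
      have : 1 - P ≠ 0 := by linarith
      have : 1 + P ≠ 0 := by linarith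
      field_simp
    rw [e] at this
    have e2 : (fun j : ℕ => ((1 - P) * P ^ j)^2) = fun j => (1-P)^2 * (P^2)^j := by
      funext j
      ring
    rw [e2]
    exact this
  rw [← hs.tsum_eq, ENNReal.ofReal_tsum_of_nonneg (fun _ => sq_nonneg _) hs.summable]
  refine tsum_congr fun j => ?_
  rw [ENNReal.ofReal_pow]
  have : 0 < 1 - P := by linarith
  positivity

lemma push_eq (p q : ℝ) (hp0 : 0 < p) (hp1 : p < 1) (hq0 : 0 < q) (hq1 : q < 1)
    (μ : Measure (ℕ → Bool)) [IsProbabilityMeasure μ]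
    (hV : ∀ m y, μ {x | ∀ i ≤ m, x i = y i} = ENNReal.ofReal (bV p q m y)) (n : ℕ) (hn : 1 ≤ n) :
    pushCylSum μ n = ∑ a : Bool, bPi p q a ^ 2 * ∏ i ∈ Finset.range n, bR p q (flp a i) := by
  have hN := evC_null p q hp0 hp1 hq0 hq1 μ hV
  have hae : ∀ᵐ x ∂μ, ¬ EvC x := by
    rw [ae_iff]; simpa using hN
  let F : Bool × (Fin n → ℕ) → (Fin n → Bool × ℕ) := fun t i => (flp t.1 i, t.2 i + 1)
  have hF : Function.Injective F := by
    rintro ⟨a, k⟩ ⟨b, l⟩ h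
    have h0 := congrFun h ⟨0, hn⟩
    simp only [F, flp, Prod.mk.injEq] at h0
    have : k = l := by
      funext i
      have := congrFun h i
      simp only [F, Prod.mk.injEq] at this
      omega
    exact Prod.ext h0.1 this
  have hsupp : Function.support (fun ω : Fin n → Bool × ℕ => (μ {x | ∀ i : Fin n, rle x i = ω i})^2) ⊆ Set.range F := by
    intro ω hω
    by_contra hr
    apply hω
    have : μ {x | ∀ i : Fin n, rle x i = ω i} = 0 := by
      refine measure_mono_null ?_ hN
      intro x hx
      by_contra hx2
      apply hr
      choose k hk using fun i => (rle_shape x hx2 i).2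
      refine ⟨(x 0, fun i => k i), ?_⟩
      funext i
      rw [← hx i]
      exact Prod.ext (rle_shape x hx2 i).1.symm (hk i).symm
    simp [this]
  have hval : ∀ t : Bool × (Fin n → ℕ), (μ {x | ∀ i : Fin n, rle x i = F t i})^2 =
      ENNReal.ofReal (bPi p q t.1) ^ 2 * ∏ i : Fin n,
        (ENNReal.ofReal ((1 - bP p q (flp t.1 i)) * bP p q (flp t.1 i) ^ (t.2 i))) ^ 2 := by
    rintro ⟨a, k⟩
    let k' : ℕ → ℕ := fun i => if h : i < n then k ⟨i, h⟩ else 0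
    have hk' : ∀ i : Fin n, k' i = k i := fun i => by simp [k']
    obtain ⟨y, hy1, hy2, hy0, hy3⟩ := main_cyl p q a k' n
    have : μ {x | ∀ i : Fin n, rle x i = F (a, k) i} = μ {x | ∀ i ≤ ssum k' n, x i = y i} := by
      apply measure_congr
      filter_upwards [hae] with x hx
      apply propext
      change (∀ i : Fin n, rle x i = F (a, k) i) ↔ (∀ i ≤ ssum k' n, x i = y i)
      rw [← hy3 x hx]
      constructor
      · intro h
        refine ⟨congrArg Prod.fst (h ⟨0, hn⟩), fun i hi => ?_⟩
        have := h ⟨i, hi⟩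
        simpa [F, k', hi] using this
      · rintro ⟨_, h⟩ i
        have := h i i.2
        simpa [F, k'] using this
    rw [this, hV, hy1, ENNReal.ofReal_mul (bPi_pos p q hp1 hq1 a).le, mul_pow, Finset.prod_range,
      ENNReal.ofReal_prod_of_nonneg, ← Finset.prod_pow]
    · simp only [hk']
    · intro i _
      obtain ⟨h1, h2⟩ := bP_mem p q hp0 hp1 hq0 hq1 (flp a i)
      have : 0 < 1 - bP p q (flp a i) := by linarith
      positivity
  have hr : ∀ a, 0 ≤ bR p q a := fun a => by
    obtain ⟨h1, h2⟩ := bP_mem p q hp0 hp1 hq0 hq1 a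
    exact div_nonneg (by linarith) (by linarith)
  have e1 : ∑' ω : Fin n → Bool × ℕ, (μ {x | ∀ i : Fin n, rle x i = ω i})^2 =
      ENNReal.ofReal (∑ a : Bool, bPi p q a ^ 2 * ∏ i ∈ Finset.range n, bR p q (flp a i)) := by
    rw [← hF.tsum_eq hsupp]
    simp only [hval]
    rw [ENNReal.tsum_prod', tsum_fintype, ENNReal.ofReal_sum_of_nonneg]
    · refine Finset.sum_congr rfl fun a _ => ?_
      dsimp only
      rw [ENNReal.tsum_mul_left, ENNReal.ofReal_mul (sq_nonneg _), ENNReal.ofReal_pow (bPi_pos p q hp1 hq1 a).le,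
        ENNReal.ofReal_prod_of_nonneg (fun i _ => hr _)]
      congr 1
      rw [tsum_pi_prod n (fun i j => (ENNReal.ofReal ((1 - bP p q (flp a i)) * bP p q (flp a i) ^ j)) ^ 2)]
      refine Finset.prod_congr rfl fun i _ => ?_
      obtain ⟨h1, h2⟩ := bP_mem p q hp0 hp1 hq0 hq1 (flp a i)
      exact geo _ h1 h2
    · intro a _
      exact mul_nonneg (sq_nonneg _) (Finset.prod_nonneg fun i _ => hr _)
  unfold pushCylSum
  simp only [← ENNReal.toReal_pow]
  rw [← ENNReal.tsum_toReal_eq, e1, ENNReal.toReal_ofReal]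
  · exact Finset.sum_nonneg fun a _ => mul_nonneg (sq_nonneg _) (Finset.prod_nonneg fun i _ => hr _)
  · intro ω
    exact ENNReal.pow_ne_top (measure_ne_top _ _)

lemma asym (C : ℕ → ℝ) (R : ℝ) (hR : 0 < R) (hC : ∀ n, 0 < C n) (hC2 : ∀ n, C (n+2) = R * C n) :
    Tendsto (fun n : ℕ => Real.log (C n) / n) atTop (𝓝 (1/2 * Real.log R)) := by
  set B := |Real.log (C 0)| + |Real.log (C 1) - 1/2 * Real.log R| with hB
  have h : ∀ n : ℕ, |Real.log (C n) - n * (1/2 * Real.log R)| ≤ B := by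
    intro n
    induction n using Nat.twoStepInduction with
    | zero => simp [hB]
    | one => simp [hB]
    | more n ih _ =>
      rw [hC2, Real.log_mul hR.ne' (hC n).ne']
      push_cast
      convert ih using 2
      ring
  rw [tendsto_iff_norm_sub_tendsto_zero]
  refine squeeze_zero' (Eventually.of_forall fun _ => norm_nonneg _) ?_
    (tendsto_const_div_atTop_nhds_zero_nat B)
  filter_upwards [eventually_gt_atTop 0] with n hn
  have hn' : (0:ℝ) < n := by exact_mod_cast hn
  rw [Real.norm_eq_abs]
  have : Real.log (C n) / n - 1/2 * Real.log R = (Real.log (C n) - n * (1/2 * Real.log R)) / n := by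
    field_simp
  rw [this, abs_div, abs_of_pos hn']
  gcongr
  exact h n

/-- Example `exmark1`: for the stationary two-state Markov measure
(`p_{aa} = p`, `p_{bb} = q`, `0 < p,q < 1`), the Rényi entropy of order 2 of `f_*μ`
exists and `H₂(f_*μ) = -(1/2) log((1-p)(1-q)/((1+p)(1+q)))`. -/
theorem stmt15 (p q : ℝ) (hp0 : 0 < p) (hp1 : p < 1) (hq0 : 0 < q) (hq1 : q < 1)
    (μ : Measure (ℕ → Bool)) [IsProbabilityMeasure μ]
    (hμ : ∀ (n : ℕ) (w : Fin (n + 1) → Bool),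
      μ {x | ∀ i : Fin (n + 1), x i = w i} =
        ENNReal.ofReal
          ((if w 0 then (1 - q) / (2 - p - q) else (1 - p) / (2 - p - q)) *
            ∏ i : Fin n,
              if w i.castSucc then (if w i.succ then p else 1 - p)
              else (if w i.succ then 1 - q else q))) :
    Tendsto (fun n : ℕ => -(Real.log (pushCylSum μ n) / n)) atTop
      (𝓝 (-(1 / 2) * Real.log ((1 - p) * (1 - q) / ((1 + p) * (1 + q))))) := by
  have hV : ∀ m y, μ {x | ∀ i ≤ m, x i = y i} = ENNReal.ofReal (bV p q m y) := by
    intro m y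
    have := hμ m (fun i => y i)
    have e : {x : ℕ → Bool | ∀ i ≤ m, x i = y i} = {x | ∀ i : Fin (m+1), x i = y i} := by
      ext x
      simp [Fin.forall_iff]
    rw [e, this]
    unfold bV
    rw [Finset.prod_range]
    rfl
  have hr : ∀ a, 0 < bR p q a := fun a => by
    obtain ⟨h1, h2⟩ := bP_mem p q hp0 hp1 hq0 hq1 a
    exact div_pos (by linarith) (by linarith)
  have hR : (1 - p) * (1 - q) / ((1 + p) * (1 + q)) = bR p q true * bR p q false := by
    simp [bR, bP, div_mul_div_comm]
  have hA := asym (fun n => ∑ a : Bool, bPi p q a ^ 2 * ∏ i ∈ Finset.range n, bR p q (flp a i))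
    (bR p q true * bR p q false) (mul_pos (hr _) (hr _))
    (fun n => Finset.sum_pos (fun a _ => mul_pos (pow_pos (bPi_pos p q hp1 hq1 a) 2)
      (Finset.prod_pos fun i _ => hr _)) Finset.univ_nonempty)
    (fun n => by
      have hh : ∀ b : Bool, bR p q b * bR p q (!b) = bR p q true * bR p q false := by
        intro b; cases b <;> simp [mul_comm]
      rw [Finset.mul_sum]
      refine Finset.sum_congr rfl fun a _ => ?_
      rw [Finset.prod_range_succ, Finset.prod_range_succ, flp_succ, mul_assoc (∏ i ∈ _, _), hh]
      ring)
  rw [hR, neg_mul]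
  refine Tendsto.neg (hA.congr' ?_)
  filter_upwards [eventually_ge_atTop 1] with n hn
  rw [push_eq p q hp0 hp1 hq0 hq1 μ hV n hn]
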